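/- arXiv:2106.10810 — 3 statements merged into one kernel-verified Lean document; each statement's English description precedes it below -/
import Mathlib

section
/- Let ABCD be a rectangle in the Euclidean plane with center I, and let P be a point in the plane. Let P_a, P_b, P_c, P_d be the reflections of P in the lines AB, BC, CD, DA respectively. Assume the triangles P_aAB, P_cCD, P_bBC, P_dDA are nondegenerate with centroid distinct from circumcenter. Suppose Q is a point lying on both the Euler line of triangle P_aAB and the Euler line of triangle P_cCD, and R is a point lying on both the Euler line of triangle P_bBC and the Euler line of triangle P_dDA. Then the midpoint of Q and R lies on the line through I and P (assuming P ≠ I). -/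
open EuclideanGeometry
open scoped InnerProductSpace

noncomputable section

/-- The Euclidean plane. -/
abbrev Pt := EuclideanSpace ℝ (Fin 2)

/-- The circumcenter of the nondegenerate triangle `ABC`. -/
noncomputable def circum (A B C : Pt) (h : AffineIndependent ℝ ![A, B, C]) : Pt :=
  (⟨![A, B, C], h⟩ : Affine.Triangle ℝ Pt).circumcenter

/-- The centroid of the triangle `ABC`. -/
noncomputable def ctr (A B C : Pt) : Pt := Finset.univ.centroid ℝ ![A, B, C]

/-- The Euler line of a nondegenerate triangle: the line (affine span) through its
centroid and its circumcenter. -/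
noncomputable def eulerLine (A B C : Pt) (h : AffineIndependent ℝ ![A, B, C]) :
    AffineSubspace ℝ Pt :=
  affineSpan ℝ {ctr A B C, circum A B C h}

/-- The reflection of the point `X` in the line through `A` and `B`. -/
noncomputable def reflLine (A B X : Pt) : Pt :=
  EuclideanGeometry.reflection (affineSpan ℝ {A, B}) X

/-- Two nonzero orthogonal vectors of the plane span it. -/
lemma exists_eq_smul_add_smul_of_inner_eq_zero {u v : Pt} (hu : u ≠ 0) (hv : v ≠ 0)
    (huv : ⟪u, v⟫_ℝ = 0) (w : Pt) : ∃ a b : ℝ, w = a • u + b • v := by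
  have hli : LinearIndependent ℝ ![u, v] := by
    refine linearIndependent_of_ne_zero_of_inner_eq_zero (𝕜 := ℝ) ?_ ?_
    · intro i; fin_cases i <;> simpa
    · intro i j hij
      fin_cases i <;> fin_cases j <;> simp_all [real_inner_comm]
  have hmem : w ∈ Submodule.span ℝ (Set.range ![u, v]) := by
    rw [hli.span_eq_top_of_card_eq_finrank' (by simp)]
    trivial
  rw [Matrix.range_cons_cons_empty, Submodule.mem_span_pair] at hmem
  obtain ⟨a, b, h⟩ := hmem
  exact ⟨a, b, h.symm⟩

lemma coeff_eq_of_inner_eq_zero {u v : Pt} (hu : u ≠ 0) (hv : v ≠ 0)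
    (huv : ⟪u, v⟫_ℝ = 0) {a b c d : ℝ} (h : a • u + b • v = c • u + d • v) :
    a = c ∧ b = d := by
  have h1 := congrArg (fun w => ⟪u, w⟫_ℝ) h
  have h2 := congrArg (fun w => ⟪v, w⟫_ℝ) h
  have huv' : ⟪v, u⟫_ℝ = 0 := by rw [real_inner_comm, huv]
  simp only [inner_add_right, inner_smul_right, huv, huv', mul_zero, add_zero, zero_add] at h1 h2
  exact ⟨mul_right_cancel₀ (inner_self_ne_zero.2 hu) h1,
    mul_right_cancel₀ (inner_self_ne_zero.2 hv) h2⟩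

lemma dist_add_smul_add_smul_sq {u v : Pt} (huv : ⟪u, v⟫_ℝ = 0) (O : Pt) (a b c d : ℝ) :
    dist (O + a • u + b • v) (O + c • u + d • v) ^ 2 =
      (a - c) ^ 2 * ⟪u, u⟫_ℝ + (b - d) ^ 2 * ⟪v, v⟫_ℝ := by
  have huv' : ⟪v, u⟫_ℝ = 0 := by rw [real_inner_comm, huv]
  have h : O + a • u + b • v - (O + c • u + d • v) = (a - c) • u + (b - d) • v := by module
  rw [dist_eq_norm, h, ← real_inner_self_eq_norm_sq]
  simp only [inner_add_left, inner_add_right, real_inner_smul_left, real_inner_smul_right, huv,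
    huv']
  ring

lemma reflLine_of_inner_eq_zero {u v : Pt} (huv : ⟪u, v⟫_ℝ = 0) (O : Pt) (x y : ℝ) :
    reflLine (O - u - v) (O + u - v) (O + x • u + y • v) = O + x • u + (-2 - y) • v := by
  have hmem : O + x • u - v ∈ affineSpan ℝ {O - u - v, O + u - v} := by
    have h : O + x • u - v = AffineMap.lineMap (O - u - v) (O + u - v) ((x + 1) / 2) := by
      rw [AffineMap.lineMap_apply, vsub_eq_sub, vadd_eq_add]
      module
    rw [h]
    exact AffineMap.lineMap_mem_affineSpan_pair _ _ _
  have hv : (y + 1) • v ∈ (affineSpan ℝ {O - u - v, O + u - v}).directionᗮ := by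
    rw [Submodule.mem_orthogonal]
    intro w hw
    rw [direction_affineSpan, mem_vectorSpan_pair] at hw
    obtain ⟨r, rfl⟩ := hw
    have h : r • (O - u - v -ᵥ (O + u - v)) = (-2 * r) • u := by
      rw [vsub_eq_sub]
      module
    rw [h, inner_smul_left, inner_smul_right, huv]
    simp
  have h := EuclideanGeometry.reflection_orthogonal_vadd hmem hv
  rw [vadd_eq_add, vadd_eq_add] at h
  rw [reflLine]
  convert h using 1
  · congr 1
    module
  · module

lemma ctr_eq (A B C : Pt) : ctr A B C = (1 / 3 : ℝ) • (A + B + C) := by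
  rw [ctr, Finset.centroid_def, Finset.affineCombination_eq_linear_combination _ _ _
    (Finset.sum_centroidWeights_eq_one_of_nonempty ℝ _ Finset.univ_nonempty)]
  simp [Fin.sum_univ_three]

/-- Coordinates of the points of the Euler line of the triangle formed by the reflection of
`P = (x, y)` in the side `v = -1` of a rectangle and the endpoints `(-1, -1)`, `(1, -1)` of that
side; here `(0, m - 1)` is the circumcenter. -/
lemma exists_of_mem_eulerLine {u v : Pt} (hu : u ≠ 0) (hv : v ≠ 0) (huv : ⟪u, v⟫_ℝ = 0)
    {O A B T Q : Pt} {x y X Y : ℝ} (hA : A = O - u - v) (hB : B = O + u - v)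
    (hT : T = reflLine A B (O + x • u + y • v)) (h : AffineIndependent ℝ ![T, A, B])
    (hQ : Q = O + X • u + Y • v) (hmem : Q ∈ eulerLine T A B h) :
    ∃ l m : ℝ, y + 1 ≠ 0 ∧
      2 * (y + 1) * m * ⟪v, v⟫_ℝ = ⟪u, u⟫_ℝ * (1 - x ^ 2) - (y + 1) ^ 2 * ⟪v, v⟫_ℝ ∧
      X = l * x ∧ Y = -1 + (1 - 3 * l) * m - l * (y + 1) := by
  have hU : ⟪u, u⟫_ℝ ≠ 0 := inner_self_ne_zero.2 hu
  obtain ⟨p, q, hpq⟩ := exists_eq_smul_add_smul_of_inner_eq_zero hu hv huv (circum T A B h - O)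
  have hc : circum T A B h = O + p • u + q • v := by
    rw [add_assoc, ← hpq]
    abel
  have hT' : T = O + x • u + (-2 - y) • v := by
    rw [hT, hA, hB, reflLine_of_inner_eq_zero huv]
  have hA' : A = O + (-1 : ℝ) • u + (-1 : ℝ) • v := by rw [hA]; module
  have hB' : B = O + (1 : ℝ) • u + (-1 : ℝ) • v := by rw [hB]; module
  have hd (i : Fin 3) : dist (![T, A, B] i) (circum T A B h) ^ 2 =
      (⟨![T, A, B], h⟩ : Affine.Triangle ℝ Pt).circumradius ^ 2 := by
    rw [← Affine.Simplex.dist_circumcenter_eq_circumradius _ i, circum]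
  generalize (⟨![T, A, B], h⟩ : Affine.Triangle ℝ Pt).circumradius = ρ at hd
  have h0 := hd 0
  have h1 := hd 1
  have h2 := hd 2
  simp only [Matrix.cons_val] at h0 h1 h2
  rw [hc, hT', dist_add_smul_add_smul_sq huv] at h0
  rw [hc, hA', dist_add_smul_add_smul_sq huv] at h1
  rw [hc, hB', dist_add_smul_add_smul_sq huv] at h2
  have hp : p = 0 := by
    refine (mul_eq_zero.1 ?_).resolve_right hU
    linear_combination (h1 - h2) / 4
  subst hp
  rw [eulerLine, hc, ctr_eq] at hmem
  obtain ⟨r, hr⟩ := mem_affineSpan_pair_iff_exists_lineMap_eq.1 hmem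
  have hQ' : X • u + Y • v =
      ((1 - r) * x / 3) • u + (r * q + (1 - r) * (-4 - y) / 3) • v := by
    have : X • u + Y • v = Q - O := by rw [hQ]; module
    rw [this, ← hr, AffineMap.lineMap_apply, vsub_eq_sub, vadd_eq_add, hT', hA', hB']
    module
  obtain ⟨hX, hY⟩ := coeff_eq_of_inner_eq_zero hu hv huv hQ'
  refine ⟨(1 - r) / 3, q + 1, ?_, ?_, ?_, ?_⟩
  · intro hy
    obtain rfl : y = -1 := by linarith
    have hx : (x - 1) * (x + 1) = 0 := by
      refine (mul_eq_zero.1 ?_).resolve_right hU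
      linear_combination h0 - h1
    rcases mul_eq_zero.1 hx with hx | hx
    · have hTB : T = B := by
        rw [hT', hB', show x = 1 by linarith]
        norm_num
      exact absurd (h.injective (a₁ := 0) (a₂ := 2) (by simpa using hTB)) (by decide)
    · have hTA : T = A := by
        rw [hT', hA', show x = -1 by linarith]
        norm_num
      exact absurd (h.injective (a₁ := 0) (a₂ := 1) (by simpa using hTA)) (by decide)
  · linear_combination h0 - h1
  · rw [hX]; ring
  · rw [hY]; ring

/-- Coordinates of a common point of the Euler lines belonging to two opposite sides. -/
lemma coords_of_mem_eulerLine_of_mem_eulerLine {u v : Pt} (hu : u ≠ 0) (hv : v ≠ 0)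
    (huv : ⟪u, v⟫_ℝ = 0) {O A B C D T S Q : Pt} {x y X Y : ℝ}
    (hA : A = O - u - v) (hB : B = O + u - v) (hC : C = O + u + v) (hD : D = O - u + v)
    (hT : T = reflLine A B (O + x • u + y • v)) (hS : S = reflLine C D (O + x • u + y • v))
    (h₁ : AffineIndependent ℝ ![T, A, B]) (h₂ : AffineIndependent ℝ ![S, C, D])
    (hQ : Q = O + X • u + Y • v)
    (hQ₁ : Q ∈ eulerLine T A B h₁) (hQ₂ : Q ∈ eulerLine S C D h₂) :
    (x = 0 → X = 0) ∧ (x ≠ 0 →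
      ⟪v, v⟫_ℝ * (y ^ 2 - 1) + 3 * (⟪u, u⟫_ℝ * (1 - x ^ 2)) ≠ 0 ∧
      X * (⟪v, v⟫_ℝ * (y ^ 2 - 1) + 3 * (⟪u, u⟫_ℝ * (1 - x ^ 2))) =
        x * (3 * (⟪v, v⟫_ℝ * (y ^ 2 - 1)) + ⟪u, u⟫_ℝ * (1 - x ^ 2)) ∧
      Y * (⟪v, v⟫_ℝ * (y ^ 2 - 1) + 3 * (⟪u, u⟫_ℝ * (1 - x ^ 2))) =
        y * (⟪v, v⟫_ℝ * (y ^ 2 - 1) - 5 * (⟪u, u⟫_ℝ * (1 - x ^ 2)))) := by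
  obtain ⟨l, m, hs, hm, hX, hY⟩ := exists_of_mem_eulerLine hu hv huv hA hB hT h₁ hQ hQ₁
  have hP : O + x • u + y • v = O + (-x) • (-u) + (-y) • (-v) := by module
  obtain ⟨k, n, ht, hn, hX', hY'⟩ := exists_of_mem_eulerLine (u := -u) (v := -v) (O := O)
    (X := -X) (Y := -Y) (neg_ne_zero.2 hu) (neg_ne_zero.2 hv) (by simpa using huv)
    (by rw [hC]; abel) (by rw [hD]; abel) (hP ▸ hS) h₂ (by rw [hQ]; module) hQ₂
  simp only [inner_neg_neg] at hn
  have hV : ⟪v, v⟫_ℝ ≠ 0 := inner_self_ne_zero.2 hv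
  generalize ⟪u, u⟫_ℝ = U at *
  generalize ⟪v, v⟫_ℝ = V at *
  refine ⟨fun hx => by rw [hX, hx, mul_zero], fun hx => ?_⟩
  obtain rfl : l = k := mul_right_cancel₀ hx (by linarith)
  have hst : (y + 1) * (-y + 1) ≠ 0 := mul_ne_zero hs ht
  have hl : l * (V * (y ^ 2 - 1) + 3 * (U * (1 - x ^ 2))) =
      3 * (V * (y ^ 2 - 1)) + U * (1 - x ^ 2) := by
    linear_combination V * (y + 1) * (-y + 1) * (hY + hY') +
      (1 - 3 * l) * (-y + 1) / 2 * hm + (1 - 3 * l) * (y + 1) / 2 * hn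
  have hY2 : Y * (V * (y ^ 2 - 1) + 3 * (U * (1 - x ^ 2))) =
        y * (V * (y ^ 2 - 1) - 5 * (U * (1 - x ^ 2))) := by
    apply mul_right_cancel₀ (mul_ne_zero hs hV)
    linear_combination (V * (y ^ 2 - 1) + 3 * (U * (1 - x ^ 2))) *
        ((y + 1) * V * hY + (1 - 3 * l) / 2 * hm) -
      (3 / 2 * (U * (1 - x ^ 2) - (y + 1) ^ 2 * V) + (y + 1) ^ 2 * V) * hl
  refine ⟨fun h0 => ?_, by rw [hX]; linear_combination x * hl, hY2⟩
  have h3 : V * ((y + 1) * (-y + 1)) = 0 := by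
    rw [h0] at hl
    linear_combination (3 * hl + h0) / 8
  exact mul_ne_zero hV hst h3

/-- Let `ABCD` be a rectangle with center `I`, `P` a point, and let `Pₐ`,
`P_b`, `P_c`, `P_d` be the reflections of `P` in the lines `AB`, `BC`, `CD`, `DA`.  If `Q`
lies on the Euler lines of triangles `PₐAB` and `P_cCD`, and `R` lies on the Euler lines of
triangles `P_bBC` and `P_dDA`, then the midpoint of `QR` lies on line `IP`. -/
theorem rectangle_reflections_euler_midpoint_on_line (A B C D I P : Pt)
    (hpar : A - B = D - C) (hperp : ⟪B - A, C - B⟫_ℝ = 0)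
    (hAB : A ≠ B) (hBC : B ≠ C)
    (hI : I = midpoint ℝ A C) (hPI : P ≠ I)
    (Pa Pb Pc Pd Q R : Pt)
    (hPa : Pa = reflLine A B P) (hPb : Pb = reflLine B C P)
    (hPc : Pc = reflLine C D P) (hPd : Pd = reflLine D A P)
    (h₁ : AffineIndependent ℝ ![Pa, A, B]) (h₂ : AffineIndependent ℝ ![Pc, C, D])
    (h₃ : AffineIndependent ℝ ![Pb, B, C]) (h₄ : AffineIndependent ℝ ![Pd, D, A])
    (he₁ : ctr Pa A B ≠ circum Pa A B h₁) (he₂ : ctr Pc C D ≠ circum Pc C D h₂)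
    (he₃ : ctr Pb B C ≠ circum Pb B C h₃) (he₄ : ctr Pd D A ≠ circum Pd D A h₄)
    (hQ₁ : Q ∈ eulerLine Pa A B h₁) (hQ₂ : Q ∈ eulerLine Pc C D h₂)
    (hR₁ : R ∈ eulerLine Pb B C h₃) (hR₂ : R ∈ eulerLine Pd D A h₄) :
    midpoint ℝ Q R ∈ affineSpan ℝ ({I, P} : Set Pt) := by
  have hu : (1 / 2 : ℝ) • (B - A) ≠ 0 := smul_ne_zero (by norm_num) (sub_ne_zero.2 hAB.symm)
  have hv : (1 / 2 : ℝ) • (C - B) ≠ 0 := smul_ne_zero (by norm_num) (sub_ne_zero.2 hBC.symm)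
  have huv : ⟪(1 / 2 : ℝ) • (B - A), (1 / 2 : ℝ) • (C - B)⟫_ℝ = 0 := by
    rw [inner_smul_left, inner_smul_right, hperp]
    simp
  have hI' : I = (1 / 2 : ℝ) • (A + C) := by
    rw [hI, midpoint_eq_smul_add, invOf_eq_inv, one_div]
  have hA : A = I - (1 / 2 : ℝ) • (B - A) - (1 / 2 : ℝ) • (C - B) := by rw [hI']; module
  have hB : B = I + (1 / 2 : ℝ) • (B - A) - (1 / 2 : ℝ) • (C - B) := by rw [hI']; module
  have hC : C = I + (1 / 2 : ℝ) • (B - A) + (1 / 2 : ℝ) • (C - B) := by rw [hI']; module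
  have hD : D = I - (1 / 2 : ℝ) • (B - A) + (1 / 2 : ℝ) • (C - B) := by
    rw [hI', show D = A - B + C by rw [hpar]; abel]
    module
  generalize (1 / 2 : ℝ) • (B - A) = u at *
  generalize (1 / 2 : ℝ) • (C - B) = v at *
  have hcoord (Z : Pt) : ∃ a b : ℝ, Z = I + a • u + b • v := by
    obtain ⟨a, b, h⟩ := exists_eq_smul_add_smul_of_inner_eq_zero hu hv huv (Z - I)
    exact ⟨a, b, by rw [add_assoc, ← h]; abel⟩
  obtain ⟨x, y, hP⟩ := hcoord P
  obtain ⟨X, Y, hQ⟩ := hcoord Q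
  obtain ⟨Z, W, hR⟩ := hcoord R
  have hP' : P = I + y • v + (-x) • (-u) := by rw [hP]; module
  obtain ⟨hQ0, hQx⟩ := coords_of_mem_eulerLine_of_mem_eulerLine hu hv huv hA hB hC hD
    (hP ▸ hPa) (hP ▸ hPc) h₁ h₂ hQ hQ₁ hQ₂
  obtain ⟨hR0, hRy⟩ := coords_of_mem_eulerLine_of_mem_eulerLine (u := v) (v := -u) (O := I)
    (X := W) (Y := -Z) hv (neg_ne_zero.2 hu) (by rw [inner_neg_right, real_inner_comm, huv, neg_zero])
    (by rw [hB]; abel) (by rw [hC]; abel) (by rw [hD]; abel) (by rw [hA]; abel)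
    (hP' ▸ hPb) (hP' ▸ hPd) h₃ h₄ (by rw [hR]; module) hR₁ hR₂
  simp only [inner_neg_neg] at hRy
  have hxy : x ≠ 0 ∨ y ≠ 0 := by
    by_contra! h
    exact hPI (by rw [hP, h.1, h.2]; simp)
  suffices h : ∃ t : ℝ, X + Z = 2 * (t * x) ∧ Y + W = 2 * (t * y) by
    obtain ⟨t, hX, hY⟩ := h
    have hm : midpoint ℝ Q R = AffineMap.lineMap I P t := by
      rw [midpoint_eq_smul_add, invOf_eq_inv, AffineMap.lineMap_apply, vsub_eq_sub, vadd_eq_add,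
        hQ, hR, hP, eq_sub_of_add_eq hX, eq_sub_of_add_eq hY]
      module
    rw [hm]
    exact AffineMap.lineMap_mem_affineSpan_pair _ _ _
  generalize ⟪u, u⟫_ℝ = U at *
  generalize ⟪v, v⟫_ℝ = V at *
  have hcross : (X + Z) * y = (Y + W) * x := by
    by_cases hx : x = 0
    · have hy : y ≠ 0 := hxy.resolve_left (not_not.2 hx)
      obtain ⟨hne, -, hZ⟩ := hRy hy
      have hZ0 : Z = 0 := by
        refine (mul_eq_zero.1 ?_).resolve_right hne
        rw [hx] at hZ ⊢
        linear_combination -hZ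
      rw [hQ0 hx, hZ0, hx]
      ring
    · obtain ⟨hne, hX, hY⟩ := hQx hx
      by_cases hy : y = 0
      · have hY0 : Y = 0 := by
          refine (mul_eq_zero.1 ?_).resolve_right hne
          rw [hY, hy, zero_mul]
        rw [hR0 hy, hY0, hy]
        ring
      · obtain ⟨hne', hW, hZ⟩ := hRy hy
        have h1 : X * y - Y * x = 2 * (x * y) := by
          apply mul_right_cancel₀ hne
          linear_combination y * hX - x * hY
        have h2 : W * x - Z * y = 2 * (x * y) := by
          apply mul_right_cancel₀ hne'
          linear_combination x * hW + y * hZ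
        linear_combination h1 - h2
  rcases hxy with hx | hy
  · refine ⟨(X + Z) / (2 * x), by field_simp, ?_⟩
    field_simp
    linear_combination -hcross
  · refine ⟨(Y + W) / (2 * y), ?_, by field_simp⟩
    field_simp
    linear_combination hcross
end
end

section
/- Let ABCD be a rectangle in the Euclidean plane and let P be a point in the plane, with P not lying on any of the lines AB, BC, CD, DA, AC, BD. Let P_a, P_b, P_c, P_d be the reflections of P in the lines AB, BC, CD, DA respectively, and let P_ac, P_bd be the reflections of P in the lines AC, BD respectively. Let U_1, U_2, U_3, U_4 be the orthogonal projections of P_ac onto the lines P_aP_b, P_bP_c, P_cP_d, P_dP_a respectively, and let V_1, V_2, V_3, V_4 be the orthogonal projections of P_bd onto those same four lines. Suppose Q is a point lying on both line U_1U_3 and line U_2U_4, and R is a point lying on both line V_1V_3 and line V_2V_4 (assuming U_1 ≠ U_3, U_2 ≠ U_4, V_1 ≠ V_3, V_2 ≠ V_4, and that consecutive vertices among P_a, P_b, P_c, P_d are distinct). Then the points P, Q and R are collinear. -/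
open EuclideanGeometry
open scoped InnerProductSpace

noncomputable section

/-- The orthogonal projection of the point `X` onto the line through `A` and `B`. -/
noncomputable def projLine (A B X : Pt) : Pt :=
  (EuclideanGeometry.orthogonalProjection (affineSpan ℝ {A, B}) X : Pt)

/-- The point with coordinates `(x, y)` in the frame with origin `P` and axes `e`. -/
def framePoint (P : Pt) (e : OrthonormalBasis (Fin 2) ℝ Pt) (x y : ℝ) : Pt :=
  P + x • e 0 + y • e 1

section Frame

variable (P : Pt) (e : OrthonormalBasis (Fin 2) ℝ Pt)

lemma framePoint_zero : framePoint P e 0 0 = P := by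
  simp [framePoint]

lemma framePoint_vsub (x y x' y' : ℝ) :
    framePoint P e x y -ᵥ framePoint P e x' y' = (x - x') • e 0 + (y - y') • e 1 := by
  simp only [framePoint, vsub_eq_sub]
  module

lemma exists_framePoint_eq (X : Pt) : ∃ x y, X = framePoint P e x y := by
  refine ⟨⟪e 0, X - P⟫_ℝ, ⟪e 1, X - P⟫_ℝ, ?_⟩
  have h := e.sum_repr' (X - P)
  rw [Fin.sum_univ_two] at h
  rw [framePoint, add_assoc, h, add_sub_cancel]

lemma inner_frame (x y x' y' : ℝ) :
    ⟪x • e 0 + y • e 1, x' • e 0 + y' • e 1⟫_ℝ = x * x' + y * y' := by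
  simp [inner_add_left, inner_add_right, inner_smul_left, inner_smul_right, e.inner_eq_ite]
  ring

variable {P e}

lemma framePoint_inj {x y x' y' : ℝ} (h : framePoint P e x y = framePoint P e x' y') :
    x = x' ∧ y = y' := by
  have h0 : (x - x') • e 0 + (y - y') • e 1 = 0 := by
    rw [← framePoint_vsub P, h, vsub_self]
  have h1 := inner_frame e (x - x') (y - y') (x - x') (y - y')
  rw [h0, inner_zero_left] at h1
  constructor <;> nlinarith [sq_nonneg (x - x'), sq_nonneg (y - y')]

lemma lineMap_framePoint (x y x' y' r : ℝ) :
    AffineMap.lineMap (framePoint P e x y) (framePoint P e x' y') r =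
      framePoint P e (x + r * (x' - x)) (y + r * (y' - y)) := by
  simp only [framePoint, AffineMap.lineMap_apply, vsub_eq_sub, vadd_eq_add]
  module

lemma framePoint_mem_line {x₁ y₁ x₂ y₂ x y : ℝ}
    (hne : (x₂ - x₁) ^ 2 + (y₂ - y₁) ^ 2 ≠ 0)
    (h : (x - x₁) * (y₂ - y₁) = (y - y₁) * (x₂ - x₁)) :
    framePoint P e x y ∈ affineSpan ℝ {framePoint P e x₁ y₁, framePoint P e x₂ y₂} := by
  rw [mem_affineSpan_pair_iff_exists_lineMap_eq]
  refine ⟨((x - x₁) * (x₂ - x₁) + (y - y₁) * (y₂ - y₁)) /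
    ((x₂ - x₁) ^ 2 + (y₂ - y₁) ^ 2), ?_⟩
  rw [lineMap_framePoint]
  congr 1
  · field_simp
    linear_combination (-(y₂ - y₁)) * h
  · field_simp
    linear_combination (x₂ - x₁) * h

lemma projLine_framePoint {x₁ y₁ x₂ y₂ x y z w : ℝ}
    (hne : (x₂ - x₁) ^ 2 + (y₂ - y₁) ^ 2 ≠ 0)
    (h : (z - x₁) * (y₂ - y₁) = (w - y₁) * (x₂ - x₁))
    (h' : (x - z) * (x₂ - x₁) + (y - w) * (y₂ - y₁) = 0) :
    projLine (framePoint P e x₁ y₁) (framePoint P e x₂ y₂) (framePoint P e x y) =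
      framePoint P e z w := by
  rw [projLine, coe_orthogonalProjection_eq_iff_mem]
  refine ⟨framePoint_mem_line hne h, ?_⟩
  rw [direction_affineSpan, vectorSpan_pair_rev, Submodule.mem_orthogonal_singleton_iff_inner_left,
    framePoint_vsub, framePoint_vsub, inner_frame, h']

lemma reflLine_framePoint {x₁ y₁ x₂ y₂ x y z w : ℝ}
    (hne : (x₂ - x₁) ^ 2 + (y₂ - y₁) ^ 2 ≠ 0)
    (h : ((x + z) / 2 - x₁) * (y₂ - y₁) = ((y + w) / 2 - y₁) * (x₂ - x₁))
    (h' : (x - z) * (x₂ - x₁) + (y - w) * (y₂ - y₁) = 0) :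
    reflLine (framePoint P e x₁ y₁) (framePoint P e x₂ y₂) (framePoint P e x y) =
      framePoint P e z w := by
  have hp : projLine (framePoint P e x₁ y₁) (framePoint P e x₂ y₂) (framePoint P e x y) =
      framePoint P e ((x + z) / 2) ((y + w) / 2) :=
    projLine_framePoint hne h (by linear_combination h' / 2)
  rw [projLine] at hp
  rw [reflLine, EuclideanGeometry.reflection_apply', hp]
  simp only [framePoint, vsub_eq_sub, vadd_eq_add]
  module

lemma origin_mem_line {x₁ y₁ x₂ y₂ : ℝ} (hne : (x₂ - x₁) ^ 2 + (y₂ - y₁) ^ 2 ≠ 0)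
    (h : x₁ * y₂ = y₁ * x₂) :
    P ∈ affineSpan ℝ {framePoint P e x₁ y₁, framePoint P e x₂ y₂} := by
  have h' := framePoint_mem_line (P := P) (e := e) (x := 0) (y := 0) hne
    (by linear_combination -h)
  rwa [framePoint_zero] at h'

lemma reflLine_framePoint_origin {x₁ y₁ x₂ y₂ z w : ℝ}
    (hne : (x₂ - x₁) ^ 2 + (y₂ - y₁) ^ 2 ≠ 0)
    (h : (z / 2 - x₁) * (y₂ - y₁) = (w / 2 - y₁) * (x₂ - x₁))
    (h' : z * (x₂ - x₁) + w * (y₂ - y₁) = 0) :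
    reflLine (framePoint P e x₁ y₁) (framePoint P e x₂ y₂) P = framePoint P e z w := by
  have h₀ := reflLine_framePoint (P := P) (e := e) (x := 0) (y := 0)
    (z := z) (w := w) hne (by linear_combination h) (by linear_combination -h')
  rwa [framePoint_zero] at h₀

end Frame

lemma projLine_comm (X Y Z : Pt) : projLine X Y Z = projLine Y X Z := by
  simp only [projLine, Set.pair_comm X Y]

lemma exists_orthonormalBasis_of_inner_eq_zero {u v : Pt} (hu : u ≠ 0) (hv : v ≠ 0)
    (huv : ⟪u, v⟫_ℝ = 0) :
    ∃ (e : OrthonormalBasis (Fin 2) ℝ Pt) (p q : ℝ), p ≠ 0 ∧ q ≠ 0 ∧ u = p • e 0 ∧ v = q • e 1 := by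
  have hu' := norm_ne_zero_iff.2 hu
  have hv' := norm_ne_zero_iff.2 hv
  have ho : Orthonormal ℝ ![‖u‖⁻¹ • u, ‖v‖⁻¹ • v] := by
    rw [orthonormal_vecCons_iff]
    simp [norm_smul, hu', hv', inner_smul_left, inner_smul_right, huv, Orthonormal]
  let b := basisOfOrthonormalOfCardEqFinrank ho (by simp)
  have hb : ⇑b = ![‖u‖⁻¹ • u, ‖v‖⁻¹ • v] := coe_basisOfOrthonormalOfCardEqFinrank ho _
  refine ⟨b.toOrthonormalBasis (hb ▸ ho), ‖u‖, ‖v‖, hu', hv', ?_, ?_⟩ <;>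
    simp [hb, smul_smul, hu', hv']

/-- If the point `α (c, b) + β (d, a)`, with `α (b² + c²) + β (a² + d²) = ab + cd`, lies on the
line through `(d, b)` and `(c, a)`, then it is `(cd(a + b), ab(c + d)) / (ac + bd)`. -/
lemma diagonal_coefficients {a b c d α β t : ℝ} (ha : a ≠ 0) (hd : d ≠ 0) (hcd : c ≠ d)
    (hS : α * (b ^ 2 + c ^ 2) + β * (a ^ 2 + d ^ 2) = a * b + c * d)
    (hx : α * c + β * d = d + t * (c - d)) (hy : α * b + β * a = b + t * (a - b)) :
    a * c + b * d ≠ 0 ∧ α * (a * c + b * d) = a * d ∧ β * (a * c + b * d) = b * c := by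
  have hN : (d - c) ^ 2 + (b - a) ^ 2 ≠ 0 := by
    have : 0 < (d - c) ^ 2 := by positivity [sub_ne_zero.2 hcd.symm]
    positivity
  have hl : α * (2 * b * c - (a * c + b * d)) + β * (a * c + b * d - 2 * a * d) =
      b * c - a * d := by
    linear_combination (b - a) * hx - (d - c) * hy
  have hα : α * (a * c + b * d) = a * d := by
    apply mul_right_cancel₀ hN
    linear_combination (a * c + b * d - 2 * a * d) * hS - (a ^ 2 + d ^ 2) * hl
  have hβ : β * (a * c + b * d) = b * c := by
    apply mul_right_cancel₀ hN
    linear_combination (b ^ 2 + c ^ 2) * hl - (2 * b * c - (a * c + b * d)) * hS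
  refine ⟨fun hF => ?_, hα, hβ⟩
  rw [hF, mul_zero] at hα
  exact mul_ne_zero ha hd hα.symm

/-- In a frame centred at `P` with axes parallel to the sides of the rectangle, the intersection
point obtained from one diagonal lies on a line through `P` which does not depend on the
diagonal. -/
lemma exists_smul_of_mem_lines {P : Pt} {e : OrthonormalBasis (Fin 2) ℝ Pt} {a b c d : ℝ}
    (ha : a ≠ 0) (hb : b ≠ 0) (hc : c ≠ 0) (hd : d ≠ 0) (hab : a ≠ b) (hcd : c ≠ d)
    {Z U₁ U₂ U₃ U₄ Q : Pt}
    (hZ : Z = reflLine (framePoint P e a c) (framePoint P e b d) P)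
    (hU₁ : U₁ = projLine (framePoint P e 0 (2 * c)) (framePoint P e (2 * b) 0) Z)
    (hU₂ : U₂ = projLine (framePoint P e (2 * b) 0) (framePoint P e 0 (2 * d)) Z)
    (hU₃ : U₃ = projLine (framePoint P e 0 (2 * d)) (framePoint P e (2 * a) 0) Z)
    (hU₄ : U₄ = projLine (framePoint P e (2 * a) 0) (framePoint P e 0 (2 * c)) Z)
    (hQ₁ : Q ∈ affineSpan ℝ ({U₁, U₃} : Set Pt))
    (hQ₂ : Q ∈ affineSpan ℝ ({U₂, U₄} : Set Pt)) :
    ∃ r : ℝ, Q = r • ((a * b * (d - c) ^ 2 * (c + d)) • e 0 +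
      (c * d * (b - a) ^ 2 * (a + b)) • e 1) +ᵥ P := by
  have hD : d - c ≠ 0 := sub_ne_zero.2 hcd.symm
  have hE : b - a ≠ 0 := sub_ne_zero.2 hab.symm
  have hN : (d - c) ^ 2 + (b - a) ^ 2 ≠ 0 := by positivity
  have hn₁ : b ^ 2 + c ^ 2 ≠ 0 := by positivity
  have hn₂ : b ^ 2 + d ^ 2 ≠ 0 := by positivity
  have hn₄ : a ^ 2 + c ^ 2 ≠ 0 := by positivity
  have hn₃ : a ^ 2 + d ^ 2 ≠ 0 := by positivity
  obtain ⟨N, hN_def⟩ : ∃ N, N = (d - c) ^ 2 + (b - a) ^ 2 := ⟨_, rfl⟩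
  rw [← hN_def] at hN
  set p := 2 * (a * d - b * c) * (d - c) / N with hp
  set q := -(2 * (a * d - b * c) * (b - a) / N) with hq
  set l := 2 * (d - c) * (b - a) / N with hl
  have hl0 : l ≠ 0 := by positivity
  set σ := (a * b + c * d) / (b ^ 2 + c ^ 2) with hσ
  set τ := (a * b + c * d) / (a ^ 2 + d ^ 2) with hτ
  have hZ' : Z = framePoint P e p q := by
    rw [hZ]
    apply reflLine_framePoint_origin
    · rw [add_comm, ← hN_def]; exact hN
    · rw [hp, hq]; field_simp; rw [hN_def]; ring
    · rw [hp, hq]; field_simp; ring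
  rw [hZ'] at hU₁ hU₂ hU₃ hU₄
  rw [projLine_framePoint (z := p + l * (σ * c)) (w := q + l * (σ * b)) (by
      intro h; apply hn₁; linear_combination h / 4)
    (by rw [hp, hq, hl, hσ]; field_simp; rw [hN_def]; ring) (by ring)] at hU₁
  rw [projLine_framePoint (z := p + l * d) (w := q + l * b) (by
      intro h; apply hn₂; linear_combination h / 4)
    (by rw [hp, hq, hl]; field_simp; rw [hN_def]; ring) (by ring)] at hU₂
  rw [projLine_framePoint (z := p + l * (τ * d)) (w := q + l * (τ * a)) (by
      intro h; apply hn₃; linear_combination h / 4)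
    (by rw [hp, hq, hl, hτ]; field_simp; rw [hN_def]; ring) (by ring)] at hU₃
  rw [projLine_framePoint (z := p + l * c) (w := q + l * a) (by
      intro h; apply hn₄; linear_combination h / 4)
    (by rw [hp, hq, hl]; field_simp; rw [hN_def]; ring) (by ring)] at hU₄
  subst hU₁ hU₂ hU₃ hU₄
  obtain ⟨s, rfl⟩ := mem_affineSpan_pair_iff_exists_lineMap_eq.1 hQ₁
  obtain ⟨t, ht⟩ := mem_affineSpan_pair_iff_exists_lineMap_eq.1 hQ₂
  rw [lineMap_framePoint, lineMap_framePoint] at ht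
  obtain ⟨hx, hy⟩ := framePoint_inj ht
  obtain ⟨hF, hα, hβ⟩ := diagonal_coefficients (α := (1 - s) * σ) (β := s * τ) (t := t)
    (b := b) (c := c) ha hd hcd
    (by rw [hσ, hτ]; field_simp; ring)
    (mul_left_cancel₀ hl0 (by linear_combination -hx))
    (mul_left_cancel₀ hl0 (by linear_combination -hy))
  obtain ⟨F, hF_def⟩ : ∃ F, F = a * c + b * d := ⟨_, rfl⟩
  rw [← hF_def] at hF hα hβ
  refine ⟨2 / (N * F), ?_⟩
  have hα' := eq_div_of_mul_eq hF hα
  have hβ' := eq_div_of_mul_eq hF hβ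
  have hX : p + l * (σ * c) + s * (p + l * (τ * d) - (p + l * (σ * c))) =
      2 / (N * F) * (a * b * (d - c) ^ 2 * (c + d)) := by
    transitivity p + l * ((1 - s) * σ * c + s * τ * d)
    · ring
    · rw [hα', hβ', hp, hl]; field_simp; rw [hF_def]; ring
  have hY : q + l * (σ * b) + s * (q + l * (τ * a) - (q + l * (σ * b))) =
      2 / (N * F) * (c * d * (b - a) ^ 2 * (a + b)) := by
    transitivity q + l * ((1 - s) * σ * b + s * τ * a)
    · ring
    · rw [hα', hβ', hq, hl]; field_simp; rw [hF_def]; ring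
  rw [lineMap_framePoint, hX, hY, framePoint, vadd_eq_add]
  module

/-- Let `ABCD` be a rectangle and `P` a point not on any of the lines `AB`,
`BC`, `CD`, `DA`, `AC`, `BD`.  Reflect `P` in these lines to get `Pₐ`, `P_b`, `P_c`, `P_d`,
`P_ac`, `P_bd`.  Project `P_ac` orthogonally onto the four sides of quadrilateral
`PₐP_bP_cP_d` to get `U₁`, `U₂`, `U₃`, `U₄`, and likewise `P_bd` to get `V₁`, `V₂`, `V₃`,
`V₄`.  If `Q` lies on lines `U₁U₃` and `U₂U₄`, and `R` lies on lines `V₁V₃` and `V₂V₄`,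
then `P`, `Q`, `R` are collinear. -/
theorem rectangle_pedal_quadrilateral_collinear (A B C D P : Pt)
    (hpar : A - B = D - C) (hperp : ⟪B - A, C - B⟫_ℝ = 0)
    (hAB : A ≠ B) (hBC : B ≠ C)
    (hP₁ : P ∉ affineSpan ℝ ({A, B} : Set Pt)) (hP₂ : P ∉ affineSpan ℝ ({B, C} : Set Pt))
    (hP₃ : P ∉ affineSpan ℝ ({C, D} : Set Pt)) (hP₄ : P ∉ affineSpan ℝ ({D, A} : Set Pt))
    (hP₅ : P ∉ affineSpan ℝ ({A, C} : Set Pt)) (hP₆ : P ∉ affineSpan ℝ ({B, D} : Set Pt))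
    (Pa Pb Pc Pd Pac Pbd : Pt)
    (hPa : Pa = reflLine A B P) (hPb : Pb = reflLine B C P)
    (hPc : Pc = reflLine C D P) (hPd : Pd = reflLine D A P)
    (hPac : Pac = reflLine A C P) (hPbd : Pbd = reflLine B D P)
    (hab : Pa ≠ Pb) (hbc : Pb ≠ Pc) (hcd : Pc ≠ Pd) (hda : Pd ≠ Pa)
    (U₁ U₂ U₃ U₄ V₁ V₂ V₃ V₄ Q R : Pt)
    (hU₁ : U₁ = projLine Pa Pb Pac) (hU₂ : U₂ = projLine Pb Pc Pac)
    (hU₃ : U₃ = projLine Pc Pd Pac) (hU₄ : U₄ = projLine Pd Pa Pac)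
    (hV₁ : V₁ = projLine Pa Pb Pbd) (hV₂ : V₂ = projLine Pb Pc Pbd)
    (hV₃ : V₃ = projLine Pc Pd Pbd) (hV₄ : V₄ = projLine Pd Pa Pbd)
    (hU₁₃ : U₁ ≠ U₃) (hU₂₄ : U₂ ≠ U₄) (hV₁₃ : V₁ ≠ V₃) (hV₂₄ : V₂ ≠ V₄)
    (hQ₁ : Q ∈ affineSpan ℝ ({U₁, U₃} : Set Pt)) (hQ₂ : Q ∈ affineSpan ℝ ({U₂, U₄} : Set Pt))
    (hR₁ : R ∈ affineSpan ℝ ({V₁, V₃} : Set Pt)) (hR₂ : R ∈ affineSpan ℝ ({V₂, V₄} : Set Pt)) :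
    Collinear ℝ ({P, Q, R} : Set Pt) := by
  have hu : B - A ≠ 0 := sub_ne_zero.2 hAB.symm
  have hv : C - B ≠ 0 := sub_ne_zero.2 hBC.symm
  obtain ⟨e, m, n, hm, hn, hm', hn'⟩ := exists_orthonormalBasis_of_inner_eq_zero hu hv hperp
  obtain ⟨a, c, hA⟩ := exists_framePoint_eq P e A
  obtain ⟨b, rfl⟩ : ∃ b, m = b - a := ⟨m + a, by ring⟩
  obtain ⟨d, rfl⟩ : ∃ d, n = d - c := ⟨n + c, by ring⟩
  have hB : B = framePoint P e b c := by
    rw [← sub_add_cancel B A, hm', hA, framePoint, framePoint]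
    module
  have hC : C = framePoint P e b d := by
    rw [← sub_add_cancel C B, hn', hB, framePoint, framePoint]
    module
  have hD : D = framePoint P e a d := by
    rw [← sub_add_cancel D C, ← hpar, hA, hB, hC, framePoint, framePoint, framePoint, framePoint]
    module
  subst hA hB hC hD
  have hba : 0 < (b - a) ^ 2 := by positivity
  have hdc : 0 < (d - c) ^ 2 := by positivity
  have hab' : a ≠ b := fun h => hm (sub_eq_zero.2 h.symm)
  have hcd' : c ≠ d := fun h => hn (sub_eq_zero.2 h.symm)
  have hc : c ≠ 0 := fun h => hP₁ (origin_mem_line (by positivity) (by rw [h]; ring))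
  have hb : b ≠ 0 := fun h => hP₂ (origin_mem_line (by positivity) (by rw [h]; ring))
  have hd : d ≠ 0 := fun h => hP₃ (origin_mem_line
    (by rw [← neg_sub b a, neg_sq]; positivity) (by rw [h]; ring))
  have ha : a ≠ 0 := fun h => hP₄ (origin_mem_line
    (by rw [← neg_sub d c, neg_sq]; positivity) (by rw [h]; ring))
  rw [reflLine_framePoint_origin (z := 0) (w := 2 * c) (by positivity) (by ring) (by ring)] at hPa
  rw [reflLine_framePoint_origin (z := 2 * b) (w := 0) (by positivity) (by ring) (by ring)] at hPb
  rw [reflLine_framePoint_origin (z := 0) (w := 2 * d)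
    (by rw [← neg_sub b a, neg_sq]; positivity) (by ring) (by ring)] at hPc
  rw [reflLine_framePoint_origin (z := 2 * a) (w := 0)
    (by rw [← neg_sub d c, neg_sq]; positivity) (by ring) (by ring)] at hPd
  rw [hPa, hPb] at hU₁ hV₁
  rw [hPb, hPc] at hU₂ hV₂
  rw [hPc, hPd] at hU₃ hV₃
  rw [hPd, hPa] at hU₄ hV₄
  obtain ⟨r, hr⟩ := exists_smul_of_mem_lines ha hb hc hd hab' hcd' hPac hU₁ hU₂ hU₃ hU₄ hQ₁ hQ₂
  rw [projLine_comm] at hV₁ hV₂ hV₃ hV₄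
  rw [Set.pair_comm] at hR₁ hR₂
  obtain ⟨r', hr'⟩ := exists_smul_of_mem_lines hb ha hc hd hab'.symm hcd' hPbd hV₄ hV₃ hV₂ hV₁
    hR₂ hR₁
  rw [collinear_iff_of_mem (p₀ := P) (by simp)]
  refine ⟨(a * b * (d - c) ^ 2 * (c + d)) • e 0 + (c * d * (b - a) ^ 2 * (a + b)) • e 1, ?_⟩
  rintro X (rfl | rfl | rfl)
  · exact ⟨0, by simp⟩
  · exact ⟨r, hr⟩
  · refine ⟨r', hr'.trans ?_⟩
    congr 3
    · ring_nf
    · ring_nf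
end
end

section
/- Let ABCD be a rectangle in the Euclidean plane and let P be a point in the plane, with P not lying on any of the lines AB, BC, CD, DA, AC, BD. Let P_a, P_b, P_c, P_d be the reflections of P in the lines AB, BC, CD, DA respectively, and let P_ac, P_bd be the reflections of P in the lines AC, BD respectively. Let U_1, U_2, U_3, U_4 be the orthogonal projections of P_ac onto the lines P_aP_b, P_bP_c, P_cP_d, P_dP_a respectively, and let V_1, V_2, V_3, V_4 be the orthogonal projections of P_bd onto those same four lines. Suppose Q is a point lying on both line U_1U_3 and line U_2U_4, and R is a point lying on both line V_1V_3 and line V_2V_4 (assuming U_1 ≠ U_3, U_2 ≠ U_4, V_1 ≠ V_3, V_2 ≠ V_4, Q ≠ P_ac, R ≠ P_bd, and that consecutive vertices among P_a, P_b, P_c, P_d are distinct). Then the line through Q and P_ac is parallel to the line through R and P_bd, i.e. the vector P_ac - Q is a scalar multiple of the vector P_bd - R. -/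
open EuclideanGeometry
open scoped InnerProductSpace

noncomputable section

/-- The abscissa of `X` in the frame with origin `P` and basis `(c, n), (-n, c)`. -/
def frameX (c n : ℝ) (P X : Pt) : ℝ := c * (X 0 - P 0) + n * (X 1 - P 1)

/-- The ordinate of `X` in the frame with origin `P` and basis `(c, n), (-n, c)`. -/
def frameY (c n : ℝ) (P X : Pt) : ℝ := -n * (X 0 - P 0) + c * (X 1 - P 1)

lemma inner_eq_frame {c n : ℝ} (h : c ^ 2 + n ^ 2 = 1) (P X Y Z W : Pt) :
    ⟪X - Y, Z - W⟫_ℝ =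
      (frameX c n P X - frameX c n P Y) * (frameX c n P Z - frameX c n P W) +
      (frameY c n P X - frameY c n P Y) * (frameY c n P Z - frameY c n P W) := by
  simp only [PiLp.inner_apply, Fin.sum_univ_two, frameX, frameY, PiLp.sub_apply,
    RCLike.inner_apply, conj_trivial]
  linear_combination
    -((X 0 - Y 0) * (Z 0 - W 0) + (X 1 - Y 1) * (Z 1 - W 1)) * h

lemma apply_zero_sub_eq_frame {c n : ℝ} (h : c ^ 2 + n ^ 2 = 1) (P X Y : Pt) :
    X 0 - Y 0 = c * (frameX c n P X - frameX c n P Y) - n * (frameY c n P X - frameY c n P Y) := by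
  simp only [frameX, frameY]
  linear_combination -(X 0 - Y 0) * h

lemma apply_one_sub_eq_frame {c n : ℝ} (h : c ^ 2 + n ^ 2 = 1) (P X Y : Pt) :
    X 1 - Y 1 = n * (frameX c n P X - frameX c n P Y) + c * (frameY c n P X - frameY c n P Y) := by
  simp only [frameX, frameY]
  linear_combination -(X 1 - Y 1) * h

lemma eq_of_frame_eq {c n : ℝ} (h : c ^ 2 + n ^ 2 = 1) {P X Y : Pt}
    (hx : frameX c n P X = frameX c n P Y) (hy : frameY c n P X = frameY c n P Y) : X = Y := by
  have h0 := apply_zero_sub_eq_frame h P X Y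
  have h1 := apply_one_sub_eq_frame h P X Y
  rw [hx, hy, sub_self, sub_self, mul_zero, mul_zero] at h0 h1
  ext i
  fin_cases i
  · simpa [sub_eq_zero] using h0
  · simpa [sub_eq_zero] using h1

lemma exists_frame_of_mem_line (c n : ℝ) (P : Pt) {A B X : Pt}
    (hX : X ∈ affineSpan ℝ ({A, B} : Set Pt)) :
    ∃ t : ℝ,
      frameX c n P X = frameX c n P A + t * (frameX c n P B - frameX c n P A) ∧
      frameY c n P X = frameY c n P A + t * (frameY c n P B - frameY c n P A) := by
  obtain ⟨t, rfl⟩ := mem_affineSpan_pair_iff_exists_lineMap_eq.1 hX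
  refine ⟨t, ?_, ?_⟩ <;>
  · simp only [frameX, frameY, AffineMap.lineMap_apply, vsub_eq_sub, vadd_eq_add, PiLp.add_apply,
      PiLp.smul_apply, PiLp.sub_apply, smul_eq_mul]
    ring

lemma projLine_mem (A B X : Pt) : projLine A B X ∈ affineSpan ℝ ({A, B} : Set Pt) :=
  EuclideanGeometry.orthogonalProjection_mem X

lemma inner_projLine_sub (A B X : Pt) : ⟪projLine A B X - X, B - A⟫_ℝ = 0 := by
  have h := EuclideanGeometry.orthogonalProjection_vsub_mem_direction_orthogonal
    (affineSpan ℝ ({A, B} : Set Pt)) X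
  rw [real_inner_comm]
  exact (Submodule.mem_orthogonal _ _).1 h _ (AffineSubspace.vsub_mem_direction
    (right_mem_affineSpan_pair ℝ A B) (left_mem_affineSpan_pair ℝ A B))

lemma reflLine_eq (A B X : Pt) : reflLine A B X = projLine A B X - X + projLine A B X := by
  rw [reflLine, projLine, EuclideanGeometry.reflection_apply', vsub_eq_sub, vadd_eq_add]

/-- The foot of the perpendicular from `X` to `AB`, in frame coordinates. -/
lemma frame_projLine {c n : ℝ} (h : c ^ 2 + n ^ 2 = 1) (P A B X : Pt) {a₁ a₂ b₁ b₂ x₁ x₂ : ℝ}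
    (ha₁ : frameX c n P A = a₁) (ha₂ : frameY c n P A = a₂)
    (hb₁ : frameX c n P B = b₁) (hb₂ : frameY c n P B = b₂)
    (hx₁ : frameX c n P X = x₁) (hx₂ : frameY c n P X = x₂) :
    ((b₁ - a₁) ^ 2 + (b₂ - a₂) ^ 2) * (frameX c n P (projLine A B X) - x₁) =
        ((a₁ - x₁) * (b₂ - a₂) - (a₂ - x₂) * (b₁ - a₁)) * (b₂ - a₂) ∧
      ((b₁ - a₁) ^ 2 + (b₂ - a₂) ^ 2) * (frameY c n P (projLine A B X) - x₂) =
        -((a₁ - x₁) * (b₂ - a₂) - (a₂ - x₂) * (b₁ - a₁)) * (b₁ - a₁) := by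
  obtain ⟨t, h₁, h₂⟩ := exists_frame_of_mem_line c n P (projLine_mem A B X)
  have h₃ := inner_projLine_sub A B X
  rw [inner_eq_frame h P] at h₃
  subst ha₁ ha₂ hb₁ hb₂ hx₁ hx₂
  rw [h₁, h₂] at h₃ ⊢
  constructor
  · linear_combination (frameX c n P B - frameX c n P A) * h₃
  · linear_combination (frameY c n P B - frameY c n P A) * h₃

/-- The reflection of the origin `P` of the frame in `AB`, in frame coordinates. -/
lemma frame_reflLine {c n : ℝ} (h : c ^ 2 + n ^ 2 = 1) (P A B : Pt) {a₁ a₂ b₁ b₂ : ℝ}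
    (ha₁ : frameX c n P A = a₁) (ha₂ : frameY c n P A = a₂)
    (hb₁ : frameX c n P B = b₁) (hb₂ : frameY c n P B = b₂) :
    ((b₁ - a₁) ^ 2 + (b₂ - a₂) ^ 2) * frameX c n P (reflLine A B P) =
        2 * (a₁ * (b₂ - a₂) - a₂ * (b₁ - a₁)) * (b₂ - a₂) ∧
      ((b₁ - a₁) ^ 2 + (b₂ - a₂) ^ 2) * frameY c n P (reflLine A B P) =
        -2 * (a₁ * (b₂ - a₂) - a₂ * (b₁ - a₁)) * (b₁ - a₁) := by
  have hx : frameX c n P P = 0 := by simp [frameX]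
  have hy : frameY c n P P = 0 := by simp [frameY]
  obtain ⟨h₁, h₂⟩ := frame_projLine h P A B P ha₁ ha₂ hb₁ hb₂ hx hy
  have hX : frameX c n P (reflLine A B P) = 2 * frameX c n P (projLine A B P) := by
    simp only [reflLine_eq, frameX, PiLp.add_apply, PiLp.sub_apply]; ring
  have hY : frameY c n P (reflLine A B P) = 2 * frameY c n P (projLine A B P) := by
    simp only [reflLine_eq, frameY, PiLp.add_apply, PiLp.sub_apply]; ring
  rw [hX, hY]
  constructor
  · linear_combination 2 * h₁
  · linear_combination 2 * h₂

lemma frame_cross_ne_zero {c n : ℝ} (h : c ^ 2 + n ^ 2 = 1) {P A B : Pt} (hAB : A ≠ B)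
    (hP : P ∉ affineSpan ℝ ({A, B} : Set Pt)) {a₁ a₂ b₁ b₂ : ℝ}
    (ha₁ : frameX c n P A = a₁) (ha₂ : frameY c n P A = a₂)
    (hb₁ : frameX c n P B = b₁) (hb₂ : frameY c n P B = b₂) :
    a₁ * (b₂ - a₂) - a₂ * (b₁ - a₁) ≠ 0 := by
  intro h₀
  have hx : frameX c n P P = 0 := by simp [frameX]
  have hy : frameY c n P P = 0 := by simp [frameY]
  obtain ⟨h₁, h₂⟩ := frame_projLine h P A B P ha₁ ha₂ hb₁ hb₂ hx hy
  simp only [sub_zero, h₀, neg_zero, zero_mul] at h₁ h₂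
  have hd : (b₁ - a₁) ^ 2 + (b₂ - a₂) ^ 2 ≠ 0 := by
    intro hd
    have e₁ : b₁ - a₁ = 0 := by nlinarith [sq_nonneg (b₁ - a₁), sq_nonneg (b₂ - a₂)]
    have e₂ : b₂ - a₂ = 0 := by nlinarith [sq_nonneg (b₁ - a₁), sq_nonneg (b₂ - a₂)]
    exact hAB (eq_of_frame_eq h (P := P) (by linarith) (by linarith))
  have e₁ := (mul_eq_zero.1 h₁).resolve_left hd
  have e₂ := (mul_eq_zero.1 h₂).resolve_left hd
  have hF : projLine A B P = P := eq_of_frame_eq h (e₁.trans hx.symm) (e₂.trans hy.symm)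
  exact hP (hF ▸ projLine_mem A B P)

/-- Let `X` be the reflection of the origin in the diagonal of the rectangle
`[-q, p] × [-s, r]` through `(p, r)`, and let `u`, `v`, `w`, `z` be the feet of the
perpendiculars from `X` to the sides of the quadrilateral formed by the reflections of the
origin in the sides. If `Y` lies on `uw` and `vz`, then `X - Y` has direction
`(r * s * (q - p), p * q * (s - r))`. -/
lemma pedal_diagonal_intersection_direction {p q r s : ℝ}
    (hp : p ≠ 0) (hq : q ≠ 0) (hr : r ≠ 0) (hs : s ≠ 0) (hS : r + s ≠ 0) (hT : p + q ≠ 0)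
    (hg : q * r - p * s ≠ 0)
    {x₁ x₂ u₁ u₂ v₁ v₂ w₁ w₂ z₁ z₂ y₁ y₂ t t' : ℝ}
    (hx₁ : ((p + q) ^ 2 + (r + s) ^ 2) * x₁ = -2 * (q * r - p * s) * (r + s))
    (hx₂ : ((p + q) ^ 2 + (r + s) ^ 2) * x₂ = 2 * (q * r - p * s) * (p + q))
    (hu₁ : (p ^ 2 + s ^ 2) * (u₁ - x₁) = (2 * p * s - s * x₁ + p * x₂) * s)
    (hu₂ : (p ^ 2 + s ^ 2) * (u₂ - x₂) = -(2 * p * s - s * x₁ + p * x₂) * p)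
    (hv₁ : (p ^ 2 + r ^ 2) * (v₁ - x₁) = (2 * p * r - r * x₁ - p * x₂) * r)
    (hv₂ : (p ^ 2 + r ^ 2) * (v₂ - x₂) = (2 * p * r - r * x₁ - p * x₂) * p)
    (hw₁ : (q ^ 2 + r ^ 2) * (w₁ - x₁) = -(2 * q * r + r * x₁ - q * x₂) * r)
    (hw₂ : (q ^ 2 + r ^ 2) * (w₂ - x₂) = (2 * q * r + r * x₁ - q * x₂) * q)
    (hz₁ : (q ^ 2 + s ^ 2) * (z₁ - x₁) = -(2 * q * s + s * x₁ + q * x₂) * s)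
    (hz₂ : (q ^ 2 + s ^ 2) * (z₂ - x₂) = -(2 * q * s + s * x₁ + q * x₂) * q)
    (hy₁ : y₁ = u₁ + t * (w₁ - u₁)) (hy₂ : y₂ = u₂ + t * (w₂ - u₂))
    (hy₁' : y₁ = v₁ + t' * (z₁ - v₁)) (hy₂' : y₂ = v₂ + t' * (z₂ - v₂)) :
    ∃ l : ℝ, x₁ - y₁ = l * (r * s * (q - p)) ∧ x₂ - y₂ = l * (p * q * (s - r)) := by
  obtain ⟨N, hN⟩ : ∃ N, N = (p + q) ^ 2 + (r + s) ^ 2 := ⟨_, rfl⟩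
  have hN₀ : N ≠ 0 := by rw [hN]; positivity
  have hps : p ^ 2 + s ^ 2 ≠ 0 := by positivity
  have hpr : p ^ 2 + r ^ 2 ≠ 0 := by positivity
  have hqr : q ^ 2 + r ^ 2 ≠ 0 := by positivity
  have hqs : q ^ 2 + s ^ 2 ≠ 0 := by positivity
  rw [← hN] at hx₁ hx₂
  have cu : N * (2 * p * s - s * x₁ + p * x₂) = 2 * (r + s) * (p + q) * (r * s + p * q) := by
    linear_combination 2 * p * s * hN - s * hx₁ + p * hx₂
  have cw : N * (2 * q * r + r * x₁ - q * x₂) = 2 * (r + s) * (p + q) * (r * s + p * q) := by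
    linear_combination 2 * q * r * hN + r * hx₁ - q * hx₂
  have cv : N * (2 * p * r - r * x₁ - p * x₂) = 2 * (r + s) * (p + q) * (p ^ 2 + r ^ 2) := by
    linear_combination 2 * p * r * hN - r * hx₁ - p * hx₂
  have cz : N * (2 * q * s + s * x₁ + q * x₂) = 2 * (r + s) * (p + q) * (q ^ 2 + s ^ 2) := by
    linear_combination 2 * q * s * hN + s * hx₁ + q * hx₂
  have ev₁ : N * (v₁ - x₁) = 2 * (r + s) * (p + q) * r :=
    mul_left_cancel₀ hpr (by linear_combination N * hv₁ + r * cv)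
  have ev₂ : N * (v₂ - x₂) = 2 * (r + s) * (p + q) * p :=
    mul_left_cancel₀ hpr (by linear_combination N * hv₂ + p * cv)
  have ez₁ : N * (z₁ - x₁) = -2 * (r + s) * (p + q) * s :=
    mul_left_cancel₀ hqs (by linear_combination N * hz₁ - s * cz)
  have ez₂ : N * (z₂ - x₂) = -2 * (r + s) * (p + q) * q :=
    mul_left_cancel₀ hqs (by linear_combination N * hz₂ - q * cz)
  obtain ⟨E, hE⟩ : ∃ E, E = p * (q ^ 2 + r ^ 2) + q * (p ^ 2 + s ^ 2) := ⟨_, rfl⟩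
  obtain ⟨F, hF⟩ : ∃ F, F = s * (q ^ 2 + r ^ 2) + r * (p ^ 2 + s ^ 2) := ⟨_, rfl⟩
  have eu : N * ((u₁ - x₁) * E + (u₂ - x₂) * F) =
      2 * (r + s) * (p + q) * (r * s + p * q) * (q * s - p * r) :=
    mul_left_cancel₀ hps (by
      rw [hE, hF]
      linear_combination N * (p * (q ^ 2 + r ^ 2) + q * (p ^ 2 + s ^ 2)) * hu₁ +
        N * (s * (q ^ 2 + r ^ 2) + r * (p ^ 2 + s ^ 2)) * hu₂ +
        (p ^ 2 + s ^ 2) * (q * s - p * r) * cu)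
  have ew : N * ((w₁ - x₁) * E + (w₂ - x₂) * F) =
      2 * (r + s) * (p + q) * (r * s + p * q) * (q * s - p * r) :=
    mul_left_cancel₀ hqr (by
      rw [hE, hF]
      linear_combination N * (p * (q ^ 2 + r ^ 2) + q * (p ^ 2 + s ^ 2)) * hw₁ +
        N * (s * (q ^ 2 + r ^ 2) + r * (p ^ 2 + s ^ 2)) * hw₂ +
        (q ^ 2 + r ^ 2) * (q * s - p * r) * cw)
  have l₁ : N * ((y₁ - x₁) * E + (y₂ - x₂) * F) =
      2 * (r + s) * (p + q) * (r * s + p * q) * (q * s - p * r) := by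
    rw [hy₁, hy₂]
    linear_combination (1 - t) * eu + t * ew
  have l₂ : N * ((y₁ - x₁) * (p + q) - (y₂ - x₂) * (r + s)) =
      2 * (r + s) * (p + q) * (q * r - p * s) := by
    rw [hy₁', hy₂']
    linear_combination (1 - t') * ((p + q) * ev₁ - (r + s) * ev₂) +
      t' * ((p + q) * ez₁ - (r + s) * ez₂)
  have d₁ : ((p + q) * F + (r + s) * E) * (y₁ - x₁) =
      2 * (r + s) * (p + q) * (r * s * (q - p)) :=
    mul_left_cancel₀ hN₀ (by
      linear_combination F * l₂ + (r + s) * l₁ +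
        2 * (r + s) * (p + q) * (q * r - p * s) * hF -
        2 * (r + s) * (p + q) * (r * s * (q - p)) * hN)
  have d₂ : ((p + q) * F + (r + s) * E) * (y₂ - x₂) =
      2 * (r + s) * (p + q) * (p * q * (s - r)) :=
    mul_left_cancel₀ hN₀ (by
      linear_combination (p + q) * l₁ - E * l₂ -
        2 * (r + s) * (p + q) * (q * r - p * s) * hE -
        2 * (r + s) * (p + q) * (p * q * (s - r)) * hN)
  have hdet : (p + q) * F + (r + s) * E ≠ 0 := by
    intro h0
    rw [h0, zero_mul] at d₁ d₂
    have hST : 2 * (r + s) * (p + q) ≠ 0 := by positivity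
    have e₁ := (mul_eq_zero.1 ((mul_eq_zero.1 d₁.symm).resolve_left hST)).resolve_left
      (mul_ne_zero hr hs)
    have e₂ := (mul_eq_zero.1 ((mul_eq_zero.1 d₂.symm).resolve_left hST)).resolve_left
      (mul_ne_zero hp hq)
    exact hg (by linear_combination r * e₁ - p * e₂)
  refine ⟨-(2 * (r + s) * (p + q)) / ((p + q) * F + (r + s) * E), ?_, ?_⟩
  · field_simp
    linear_combination -d₁
  · field_simp
    linear_combination -d₂

lemma exists_frame_of_rectangle {A B C D : Pt} (P : Pt)
    (hpar : A - B = D - C) (hperp : ⟪B - A, C - B⟫_ℝ = 0) (hAB : A ≠ B) :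
    ∃ c n p q r s : ℝ, c ^ 2 + n ^ 2 = 1 ∧
      frameX c n P A = -q ∧ frameY c n P A = -s ∧ frameX c n P B = p ∧ frameY c n P B = -s ∧
      frameX c n P C = p ∧ frameY c n P C = r ∧ frameX c n P D = -q ∧ frameY c n P D = r := by
  have h0 : A 0 - B 0 = D 0 - C 0 := by simpa using congrArg (fun X : Pt => X 0) hpar
  have h1 : A 1 - B 1 = D 1 - C 1 := by simpa using congrArg (fun X : Pt => X 1) hpar
  have hp : (B 0 - A 0) * (C 0 - B 0) + (B 1 - A 1) * (C 1 - B 1) = 0 := by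
    simp only [PiLp.inner_apply, Fin.sum_univ_two, PiLp.sub_apply, RCLike.inner_apply,
      conj_trivial] at hperp
    linarith
  have hL : 0 < ‖B - A‖ := norm_pos_iff.2 (sub_ne_zero.2 hAB.symm)
  have hL2 : ‖B - A‖ ^ 2 = (B 0 - A 0) ^ 2 + (B 1 - A 1) ^ 2 := by
    simp [EuclideanSpace.norm_sq_eq, Fin.sum_univ_two]
  generalize ‖B - A‖ = L at hL hL2
  refine ⟨(B 0 - A 0) / L, (B 1 - A 1) / L, frameX ((B 0 - A 0) / L) ((B 1 - A 1) / L) P B,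
    -frameX ((B 0 - A 0) / L) ((B 1 - A 1) / L) P A,
    frameY ((B 0 - A 0) / L) ((B 1 - A 1) / L) P C,
    -frameY ((B 0 - A 0) / L) ((B 1 - A 1) / L) P B, ?_, ?_, ?_, ?_, ?_, ?_, ?_, ?_, ?_⟩ <;>
    simp only [frameX, frameY, neg_neg] <;> field_simp
  · linarith
  · ring
  · linear_combination hp
  · linear_combination (B 0 - A 0) * -h0 + (B 1 - A 1) * -h1 + hp
  · linear_combination -(B 0 - A 0) * h1 + (B 1 - A 1) * h0

/-- With the same configuration as in Statement 8 (reflections of `P` in the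
sides and diagonals of the rectangle, and pedal quadrilaterals of `P_ac` and `P_bd` with
diagonal intersection points `Q` and `R`), the line `QP_ac` is parallel to the line
`RP_bd`. -/
theorem rectangle_pedal_quadrilateral_parallel (A B C D P : Pt)
    (hpar : A - B = D - C) (hperp : ⟪B - A, C - B⟫_ℝ = 0)
    (hAB : A ≠ B) (hBC : B ≠ C)
    (hP₁ : P ∉ affineSpan ℝ ({A, B} : Set Pt)) (hP₂ : P ∉ affineSpan ℝ ({B, C} : Set Pt))
    (hP₃ : P ∉ affineSpan ℝ ({C, D} : Set Pt)) (hP₄ : P ∉ affineSpan ℝ ({D, A} : Set Pt))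
    (hP₅ : P ∉ affineSpan ℝ ({A, C} : Set Pt)) (hP₆ : P ∉ affineSpan ℝ ({B, D} : Set Pt))
    (Pa Pb Pc Pd Pac Pbd : Pt)
    (hPa : Pa = reflLine A B P) (hPb : Pb = reflLine B C P)
    (hPc : Pc = reflLine C D P) (hPd : Pd = reflLine D A P)
    (hPac : Pac = reflLine A C P) (hPbd : Pbd = reflLine B D P)
    (hab : Pa ≠ Pb) (hbc : Pb ≠ Pc) (hcd : Pc ≠ Pd) (hda : Pd ≠ Pa)
    (U₁ U₂ U₃ U₄ V₁ V₂ V₃ V₄ Q R : Pt)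
    (hU₁ : U₁ = projLine Pa Pb Pac) (hU₂ : U₂ = projLine Pb Pc Pac)
    (hU₃ : U₃ = projLine Pc Pd Pac) (hU₄ : U₄ = projLine Pd Pa Pac)
    (hV₁ : V₁ = projLine Pa Pb Pbd) (hV₂ : V₂ = projLine Pb Pc Pbd)
    (hV₃ : V₃ = projLine Pc Pd Pbd) (hV₄ : V₄ = projLine Pd Pa Pbd)
    (hU₁₃ : U₁ ≠ U₃) (hU₂₄ : U₂ ≠ U₄) (hV₁₃ : V₁ ≠ V₃) (hV₂₄ : V₂ ≠ V₄)
    (hQPac : Q ≠ Pac) (hRPbd : R ≠ Pbd)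
    (hQ₁ : Q ∈ affineSpan ℝ ({U₁, U₃} : Set Pt)) (hQ₂ : Q ∈ affineSpan ℝ ({U₂, U₄} : Set Pt))
    (hR₁ : R ∈ affineSpan ℝ ({V₁, V₃} : Set Pt)) (hR₂ : R ∈ affineSpan ℝ ({V₂, V₄} : Set Pt)) :
    ∃ t : ℝ, Pac - Q = t • (Pbd - R) := by
  obtain ⟨c, n, p, q, r, s, h, hA₁, hA₂, hB₁, hB₂, hC₁, hC₂, hD₁, hD₂⟩ :=
    exists_frame_of_rectangle P hpar hperp hAB
  have hCD : C ≠ D := by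
    rintro rfl; exact hAB (sub_eq_zero.1 (by simpa using hpar))
  have hDA : D ≠ A := by
    rintro rfl; exact hBC (by simpa using hpar)
  have n₁ := frame_cross_ne_zero h hAB hP₁ hA₁ hA₂ hB₁ hB₂
  have n₂ := frame_cross_ne_zero h hBC hP₂ hB₁ hB₂ hC₁ hC₂
  have n₃ := frame_cross_ne_zero h hCD hP₃ hC₁ hC₂ hD₁ hD₂
  have n₄ := frame_cross_ne_zero h hDA hP₄ hD₁ hD₂ hA₁ hA₂
  have hs : s ≠ 0 := by rintro rfl; simp at n₁
  have hT : p + q ≠ 0 := fun e => n₁ (by linear_combination s * e)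
  have hp : p ≠ 0 := by rintro rfl; simp at n₂
  have hS : r + s ≠ 0 := fun e => n₂ (by linear_combination p * e)
  have hr : r ≠ 0 := by rintro rfl; simp at n₃
  have hq : q ≠ 0 := by rintro rfl; simp at n₄
  have hAC : A ≠ C := by
    rintro rfl; exact hT (by linarith)
  have hBD : B ≠ D := by
    rintro rfl; exact hT (by linarith)
  have n₅ := frame_cross_ne_zero h hAC hP₅ hA₁ hA₂ hC₁ hC₂
  have n₆ := frame_cross_ne_zero h hBD hP₆ hB₁ hB₂ hD₁ hD₂
  have hg : q * r - p * s ≠ 0 := fun e => n₅ (by linear_combination -e)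
  have hg' : q * s - p * r ≠ 0 := fun e => n₆ (by linear_combination -e)
  obtain ⟨a₁, a₂⟩ := frame_reflLine h P A B hA₁ hA₂ hB₁ hB₂
  obtain ⟨b₁, b₂⟩ := frame_reflLine h P B C hB₁ hB₂ hC₁ hC₂
  obtain ⟨c₁, c₂⟩ := frame_reflLine h P C D hC₁ hC₂ hD₁ hD₂
  obtain ⟨d₁, d₂⟩ := frame_reflLine h P D A hD₁ hD₂ hA₁ hA₂
  obtain ⟨x₁, x₂⟩ := frame_reflLine h P A C hA₁ hA₂ hC₁ hC₂
  obtain ⟨y₁, y₂⟩ := frame_reflLine h P B D hB₁ hB₂ hD₁ hD₂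
  rw [← hPa] at a₁ a₂
  rw [← hPb] at b₁ b₂
  rw [← hPc] at c₁ c₂
  rw [← hPd] at d₁ d₂
  rw [← hPac] at x₁ x₂
  rw [← hPbd] at y₁ y₂
  have hT2 : (p + q) ^ 2 ≠ 0 := pow_ne_zero 2 hT
  have hS2 : (r + s) ^ 2 ≠ 0 := pow_ne_zero 2 hS
  replace a₁ : frameX c n P Pa = 0 := mul_left_cancel₀ hT2 (by linear_combination a₁)
  replace a₂ : frameY c n P Pa = -(2 * s) := mul_left_cancel₀ hT2 (by linear_combination a₂)
  replace b₁ : frameX c n P Pb = 2 * p := mul_left_cancel₀ hS2 (by linear_combination b₁)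
  replace b₂ : frameY c n P Pb = 0 := mul_left_cancel₀ hS2 (by linear_combination b₂)
  replace c₁ : frameX c n P Pc = 0 := mul_left_cancel₀ hT2 (by linear_combination c₁)
  replace c₂ : frameY c n P Pc = 2 * r := mul_left_cancel₀ hT2 (by linear_combination c₂)
  replace d₁ : frameX c n P Pd = -(2 * q) := mul_left_cancel₀ hS2 (by linear_combination d₁)
  replace d₂ : frameY c n P Pd = 0 := mul_left_cancel₀ hS2 (by linear_combination d₂)
  obtain ⟨u₁, u₁'⟩ := frame_projLine h P Pa Pb Pac a₁ a₂ b₁ b₂ rfl rfl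
  obtain ⟨u₂, u₂'⟩ := frame_projLine h P Pb Pc Pac b₁ b₂ c₁ c₂ rfl rfl
  obtain ⟨u₃, u₃'⟩ := frame_projLine h P Pc Pd Pac c₁ c₂ d₁ d₂ rfl rfl
  obtain ⟨u₄, u₄'⟩ := frame_projLine h P Pd Pa Pac d₁ d₂ a₁ a₂ rfl rfl
  obtain ⟨v₁, v₁'⟩ := frame_projLine h P Pa Pb Pbd a₁ a₂ b₁ b₂ rfl rfl
  obtain ⟨v₂, v₂'⟩ := frame_projLine h P Pb Pc Pbd b₁ b₂ c₁ c₂ rfl rfl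
  obtain ⟨v₃, v₃'⟩ := frame_projLine h P Pc Pd Pbd c₁ c₂ d₁ d₂ rfl rfl
  obtain ⟨v₄, v₄'⟩ := frame_projLine h P Pd Pa Pbd d₁ d₂ a₁ a₂ rfl rfl
  rw [← hU₁] at u₁ u₁'
  rw [← hU₂] at u₂ u₂'
  rw [← hU₃] at u₃ u₃'
  rw [← hU₄] at u₄ u₄'
  rw [← hV₁] at v₁ v₁'
  rw [← hV₂] at v₂ v₂'
  rw [← hV₃] at v₃ v₃'
  rw [← hV₄] at v₄ v₄'
  obtain ⟨t₁, q₁, q₁'⟩ := exists_frame_of_mem_line c n P hQ₁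
  obtain ⟨t₂, q₂, q₂'⟩ := exists_frame_of_mem_line c n P hQ₂
  obtain ⟨t₃, r₁, r₁'⟩ := exists_frame_of_mem_line c n P hR₁
  obtain ⟨t₄, r₂, r₂'⟩ := exists_frame_of_mem_line c n P hR₂
  obtain ⟨l, hl₁, hl₂⟩ := pedal_diagonal_intersection_direction hp hq hr hs hS hT hg
    (x₁ := frameX c n P Pac) (x₂ := frameY c n P Pac)
    (by linear_combination x₁) (by linear_combination x₂)
    (by linear_combination u₁ / 4) (by linear_combination u₁' / 4)
    (by linear_combination u₂ / 4) (by linear_combination u₂' / 4)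
    (by linear_combination u₃ / 4) (by linear_combination u₃' / 4)
    (by linear_combination u₄ / 4) (by linear_combination u₄' / 4) q₁ q₁' q₂ q₂'
  obtain ⟨m, hm₁, hm₂⟩ := pedal_diagonal_intersection_direction hp hq hs hr
    (by rwa [add_comm]) hT hg'
    (x₁ := frameX c n P Pbd) (x₂ := -frameY c n P Pbd)
    (u₁ := frameX c n P V₂) (u₂ := -frameY c n P V₂)
    (v₁ := frameX c n P V₁) (v₂ := -frameY c n P V₁)
    (w₁ := frameX c n P V₄) (w₂ := -frameY c n P V₄)
    (z₁ := frameX c n P V₃) (z₂ := -frameY c n P V₃)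
    (y₁ := frameX c n P R) (y₂ := -frameY c n P R)
    (by linear_combination y₁) (by linear_combination -y₂)
    (by linear_combination v₂ / 4) (by linear_combination -v₂' / 4)
    (by linear_combination v₁ / 4) (by linear_combination -v₁' / 4)
    (by linear_combination v₄ / 4) (by linear_combination -v₄' / 4)
    (by linear_combination v₃ / 4) (by linear_combination -v₃' / 4)
    r₂ (by linear_combination -r₂') r₁ (by linear_combination -r₁')
  have hm₀ : m ≠ 0 := by
    rintro rfl
    exact hRPbd (eq_of_frame_eq h (P := P) (by linarith) (by linarith))
  have k₁ : frameX c n P Pac - frameX c n P Q =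
      l / m * (frameX c n P Pbd - frameX c n P R) := by
    rw [hl₁, hm₁]; field_simp
  have k₂ : frameY c n P Pac - frameY c n P Q =
      l / m * (frameY c n P Pbd - frameY c n P R) := by
    have hm₂' : frameY c n P Pbd - frameY c n P R = m * (p * q * (s - r)) := by
      linear_combination -hm₂
    rw [hl₂, hm₂']; field_simp
  refine ⟨l / m, ?_⟩
  ext i
  fin_cases i
  · simp only [Fin.zero_eta, PiLp.sub_apply, PiLp.smul_apply, smul_eq_mul]
    rw [apply_zero_sub_eq_frame h P Pac Q, apply_zero_sub_eq_frame h P Pbd R, k₁, k₂]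
    ring
  · simp only [Fin.mk_one, PiLp.sub_apply, PiLp.smul_apply, smul_eq_mul]
    rw [apply_one_sub_eq_frame h P Pac Q, apply_one_sub_eq_frame h P Pbd R, k₁, k₂]
    ring
end
end
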